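/- arXiv:1203.3930 — 2 statements merged into one kernel-verified Lean document; each statement's English description precedes it below -/
import Mathlib

section
/- Let M be a positive integer and let G be a finite connected n-vertex d-regular λ-expander with λ ≤ d/(32(M+1)·log(9Md²)), and let v₀ be a vertex of G. Then there exists a function Φ : Lip_{v₀}(G;M) → ℤ such that: (i) for every f ∈ Lip_{v₀}(G;M), the number of vertices v with f(v) ∉ {Φ(f), ..., Φ(f)+M} is at most 2λn/d; and (ii) for every vertex v of G and every positive integer t, the number of f ∈ Lip_{v₀}(G;M) with dist(f(v), {Φ(f), ..., Φ(f)+M}) > (t−1)M is at most exp(−|B(v,t)|/(5(M+1))) times the total number of functions in Lip_{v₀}(G;M). -/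
/-- Number of pairs (a,b) ∈ S × T with {a,b} an edge of G. -/
def edgeCount {V : Type*} (G : SimpleGraph V) [DecidableRel G.Adj]
    (S T : Finset V) : ℕ :=
  ((S ×ˢ T).filter (fun p => G.Adj p.1 p.2)).card

/-- `G` is an `n`-vertex `d`-regular `λ`-expander. -/
def IsExpander {V : Type*} [Fintype V] (G : SimpleGraph V) [DecidableRel G.Adj]
    (d : ℕ) (lam : ℝ) : Prop :=
  (∀ v : V, G.degree v = d) ∧
  ∀ S T : Finset V,
    |(edgeCount G S T : ℝ) - (d : ℝ) / (Fintype.card V : ℝ) * S.card * T.card| ≤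
      lam * Real.sqrt ((S.card : ℝ) * T.card)

/-- `M`-Lipschitz functions on `G` vanishing at `v₀`. -/
def LipSet {V : Type*} (G : SimpleGraph V) (v₀ : V) (M : ℕ) : Set (V → ℤ) :=
  {f | f v₀ = 0 ∧ ∀ u v : V, G.Adj u v → |f u - f v| ≤ (M : ℤ)}

/-- The ball of radius `t` around `v` in the graph metric of `G`. -/
def gBall {V : Type*} (G : SimpleGraph V) (v : V) (t : ℕ) : Set V :=
  {w | G.Reachable v w ∧ G.dist v w ≤ t}

open Finset

/-- `f` changes by at most `M` along every edge of `G`. -/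
def IsLip {V : Type*} (G : SimpleGraph V) (M : ℕ) (f : V → ℤ) : Prop :=
  ∀ u v : V, G.Adj u v → |f u - f v| ≤ (M : ℤ)

theorem IsLip.neg {V : Type*} {G : SimpleGraph V} {M : ℕ} {f : V → ℤ} (hf : IsLip G M f) :
    IsLip G M (-f) := by
  intro u v h
  have := hf u v h
  rw [abs_le] at this ⊢
  simp only [Pi.neg_apply]
  omega

theorem IsLip.add_const {V : Type*} {G : SimpleGraph V} {M : ℕ} {f : V → ℤ}
    (hf : IsLip G M f) (c : ℤ) : IsLip G M (fun u => f u + c) := by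
  intro u v h
  simpa using hf u v h

/-- In a connected graph every proper nonempty set is left by some edge. -/
theorem SimpleGraph.Connected.exists_adj_mem_notMem {V : Type*} {G : SimpleGraph V}
    (hconn : G.Connected) {A : Finset V} (hA : A.Nonempty) {w : V} (hw : w ∉ A) :
    ∃ x ∈ A, ∃ y ∉ A, G.Adj x y := by
  obtain ⟨u, hu⟩ := hA
  obtain ⟨p⟩ := hconn.preconnected u w
  obtain ⟨e, -, h1, h2⟩ := p.exists_boundary_dart (A : Set V) (by simpa using hu) (by simpa using hw)
  exact ⟨e.fst, by simpa using h1, e.snd, by simpa using h2, e.adj⟩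

/-- There are at most `(2M+1)^|A|` Lipschitz functions with prescribed values off a proper
set `A`. -/
theorem exists_finset_lip_extensions {V : Type*} [Fintype V] [DecidableEq V]
    {G : SimpleGraph V} (hconn : G.Connected) (M : ℕ) (w : V) (A : Finset V) (hw : w ∉ A)
    (h : V → ℤ) :
    ∃ F : Finset (V → ℤ), F.card ≤ (2 * M + 1) ^ A.card ∧
      ∀ f, IsLip G M f → (∀ u ∉ A, f u = h u) → f ∈ F := by
  induction hn : A.card generalizing A h with
  | zero =>
    refine ⟨{h}, by simp, fun f _ hf => ?_⟩
    rw [card_eq_zero] at hn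
    subst hn
    simp only [Finset.mem_singleton]
    funext u
    exact hf u (by simp)
  | succ n ih =>
    obtain ⟨x, hx, y, hy, hxy⟩ := hconn.exists_adj_mem_notMem (A := A)
      (card_pos.mp (by omega)) hw
    choose F hFc hF using fun c : ℤ => ih (A.erase x) (by simp [hw]) (Function.update h x c)
      (by rw [card_erase_of_mem hx, hn]; rfl)
    refine ⟨(Finset.Icc (h y - M) (h y + M)).biUnion F, ?_, ?_⟩
    · refine (card_biUnion_le_card_mul _ _ _ fun c _ => hFc c).trans ?_
      rw [Int.card_Icc, pow_succ, mul_comm]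
      gcongr
      omega
    · intro f hf hfA
      rw [mem_biUnion]
      refine ⟨f x, ?_, hF _ f hf ?_⟩
      · have := hf x y hxy
        rw [hfA y hy, abs_le] at this
        rw [Finset.mem_Icc]
        omega
      · intro u hu
        by_cases hux : u = x
        · subst hux; simp
        · rw [Function.update_of_ne hux]
          exact hfA u fun h' => hu (mem_erase.mpr ⟨hux, h'⟩)

theorem finite_lipSet {V : Type*} [Fintype V] {G : SimpleGraph V} (hconn : G.Connected)
    (v₀ : V) (M : ℕ) : (LipSet G v₀ M).Finite := by
  classical
  obtain ⟨F, -, hF⟩ := exists_finset_lip_extensions hconn M v₀ (univ.erase v₀) (by simp) 0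
  refine F.finite_toSet.subset fun f hf => hF f hf.2 fun u hu => ?_
  have : u = v₀ := by simpa using hu
  rw [this, hf.1]
  rfl

/-- If the sets `A` of a family can be told apart from any `W` with `A ⊆ W` and
`D A ∩ W = ∅`, then site percolation bounds the weighted number of sets in the family. -/
theorem sum_inv_pow_card_le_one {V : Type*} [Fintype V] [DecidableEq V]
    (𝒜 : Finset (Finset V)) (D : Finset V → Finset V) (k : ℕ) (hk : 0 < k)
    (hdisj : ∀ A ∈ 𝒜, Disjoint A (D A)) (hcard : ∀ A ∈ 𝒜, (D A).card ≤ k * A.card)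
    (huniq : ∀ A ∈ 𝒜, ∀ A' ∈ 𝒜, ∀ W : Finset V, A ⊆ W → Disjoint (D A) W → A' ⊆ W →
      Disjoint (D A') W → A = A') :
    ∑ A ∈ 𝒜, ((1 : ℝ) / (4 * k)) ^ A.card ≤ 1 := by
  have hk' : (1 : ℝ) ≤ k := by exact_mod_cast hk
  set p : ℝ := 1 / (2 * k) with hp
  have hp0 : 0 < p := by positivity
  have hp1 : p ≤ 1 / 2 := by
    rw [hp, div_le_div_iff₀ (by positivity) (by norm_num)]; linarith
  set wt : Finset V → ℝ := fun W => p ^ W.card * (1 - p) ^ (Fintype.card V - W.card) with hwt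
  set E : Finset V → Finset (Finset V) := fun A => (univ \ (A ∪ D A)).powerset.image (A ∪ ·)
    with hE
  have hEmem : ∀ A ∈ 𝒜, ∀ W ∈ E A, A ⊆ W ∧ Disjoint (D A) W := by
    intro A hA W hW
    simp only [hE, mem_image, mem_powerset] at hW
    obtain ⟨X, hX, rfl⟩ := hW
    refine ⟨subset_union_left, ?_⟩
    rw [disjoint_union_right]
    refine ⟨(hdisj A hA).symm, ?_⟩
    rw [disjoint_right]
    intro x hx hxD
    have := hX hx
    simp [hxD] at this
  have hsum : ∀ A ∈ 𝒜, ((1 : ℝ) / (4 * k)) ^ A.card ≤ ∑ W ∈ E A, wt W := by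
    intro A hA
    have hinj : Set.InjOn (A ∪ ·) ((univ \ (A ∪ D A)).powerset : Set (Finset V)) := by
      intro X hX Y hY hXY
      simp only [coe_powerset, Set.mem_preimage, Set.mem_powerset_iff, coe_subset] at hX hY
      have hXA : Disjoint A X := by
        rw [disjoint_right]; intro x hx; have := hX hx; simp at this; exact this.1
      have hYA : Disjoint A Y := by
        rw [disjoint_right]; intro x hx; have := hY hx; simp at this; exact this.1
      have := congrArg (· \ A) hXY
      simpa [union_sdiff_cancel_left hXA, union_sdiff_cancel_left hYA] using this
    rw [hE, sum_image hinj]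
    have hterm : ∀ X ∈ (univ \ (A ∪ D A)).powerset, wt (A ∪ X) =
        p ^ A.card * (1 - p) ^ (D A).card *
          (p ^ X.card * (1 - p) ^ ((univ \ (A ∪ D A)).card - X.card)) := by
      intro X hX
      rw [mem_powerset] at hX
      have hXA : Disjoint A X := by
        rw [disjoint_right]; intro x hx; have := hX hx; simp at this; exact this.1
      have h1 : (A ∪ D A).card = A.card + (D A).card := card_union_of_disjoint (hdisj A hA)
      have h2 : (univ \ (A ∪ D A)).card + (A ∪ D A).card = Fintype.card V := by
        rw [card_sdiff_add_card_eq_card (subset_univ _), card_univ]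
      have h3 := card_le_card hX
      have h4 : Fintype.card V - (A.card + X.card) =
          (D A).card + ((univ \ (A ∪ D A)).card - X.card) := by omega
      simp only [hwt]
      rw [card_union_of_disjoint hXA, h4, pow_add, pow_add]
      ring
    rw [sum_congr rfl hterm, ← mul_sum, sum_pow_mul_eq_add_pow]
    have hq : (1 / 2 : ℝ) ≤ (1 - p) ^ k := by
      have h := one_add_mul_le_pow (a := -p) (by linarith) k
      have : (k : ℝ) * p = 1 / 2 := by rw [hp]; field_simp
      rw [sub_eq_add_neg]
      linarith
    have hq' : (1 / 2 : ℝ) ^ A.card ≤ (1 - p) ^ (D A).card :=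
      calc (1 / 2 : ℝ) ^ A.card ≤ ((1 - p) ^ k) ^ A.card := by gcongr
        _ = (1 - p) ^ (k * A.card) := by rw [pow_mul]
        _ ≤ (1 - p) ^ (D A).card :=
          pow_le_pow_of_le_one (by linarith) (by linarith) (hcard A hA)
    calc ((1 : ℝ) / (4 * k)) ^ A.card = p ^ A.card * (1 / 2) ^ A.card := by
          rw [← mul_pow, hp]; congr 1; field_simp; norm_num
      _ ≤ p ^ A.card * (1 - p) ^ (D A).card := by gcongr
      _ = _ := by simp
  calc ∑ A ∈ 𝒜, ((1 : ℝ) / (4 * k)) ^ A.card ≤ ∑ A ∈ 𝒜, ∑ W ∈ E A, wt W := sum_le_sum hsum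
    _ = ∑ W ∈ 𝒜.biUnion E, wt W := by
        rw [sum_biUnion]
        intro A hA A' hA' hne
        rw [Function.onFun, disjoint_left]
        intro W hW hW'
        obtain ⟨h1, h2⟩ := hEmem A hA W hW
        obtain ⟨h3, h4⟩ := hEmem A' hA' W hW'
        exact hne (huniq A hA A' hA' W h1 h2 h3 h4)
    _ ≤ ∑ W ∈ (univ : Finset V).powerset, wt W := by
        refine sum_le_sum_of_subset_of_nonneg (by simp) fun W _ _ => ?_
        have : (0 : ℝ) ≤ 1 - p := by linarith
        positivity
    _ = 1 := by
        simp only [hwt]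
        rw [← card_univ, sum_pow_mul_eq_add_pow]
        simp

/-- `y` is reached from `x` by one edge or by two consecutive edges. -/
def TwoStep {V : Type*} (G : SimpleGraph V) (x y : V) : Prop :=
  ∃ z, (z = x ∨ G.Adj x z) ∧ G.Adj z y

open Classical in
/-- Vertices reachable from `v` by one- and two-edge steps that land where `f` exceeds `M`. -/
noncomputable def cluster {V : Type*} [Fintype V] (G : SimpleGraph V) (M : ℕ) (v : V)
    (f : V → ℤ) : Finset V :=
  {u | Relation.ReflTransGen (fun x y => TwoStep G x y ∧ (M : ℤ) < f y) v u}

open Classical in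
/-- The vertices outside `A` with a neighbour in `A`. -/
noncomputable def outerBoundary {V : Type*} [Fintype V] (G : SimpleGraph V) (A : Finset V) :
    Finset V :=
  {w | w ∉ A ∧ ∃ x ∈ A, G.Adj x w}

open Classical in
/-- The vertices outside `A` within two edges of `A`. -/
noncomputable def twoStepBoundary {V : Type*} [Fintype V] (G : SimpleGraph V)
    (A : Finset V) : Finset V :=
  {w | w ∉ A ∧ ∃ x ∈ A, TwoStep G x w}

section Cluster

variable {V : Type*} [Fintype V] {G : SimpleGraph V} {M : ℕ} {v : V} {f : V → ℤ}

theorem mem_cluster {u : V} : u ∈ cluster G M v f ↔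
    Relation.ReflTransGen (fun x y => TwoStep G x y ∧ (M : ℤ) < f y) v u := by
  simp [cluster]

theorem mem_outerBoundary {A : Finset V} {w : V} :
    w ∈ outerBoundary G A ↔ w ∉ A ∧ ∃ x ∈ A, G.Adj x w := by
  simp [outerBoundary]

theorem mem_twoStepBoundary {A : Finset V} {w : V} :
    w ∈ twoStepBoundary G A ↔ w ∉ A ∧ ∃ x ∈ A, TwoStep G x w := by
  simp [twoStepBoundary]

theorem self_mem_cluster : v ∈ cluster G M v f := mem_cluster.mpr .refl

theorem mem_cluster_of_twoStep {x y : V} (hx : x ∈ cluster G M v f) (h : TwoStep G x y)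
    (hy : (M : ℤ) < f y) : y ∈ cluster G M v f :=
  mem_cluster.mpr ((mem_cluster.mp hx).tail ⟨h, hy⟩)

theorem lt_of_mem_cluster (hv : (M : ℤ) < f v) {u : V} (hu : u ∈ cluster G M v f) :
    (M : ℤ) < f u := by
  rw [mem_cluster] at hu
  cases hu with
  | refl => exact hv
  | tail _ h => exact h.2

theorem mem_outerBoundary_of_adj {A : Finset V} {x w : V} (hx : x ∈ A) (hw : w ∉ A)
    (h : G.Adj x w) : w ∈ outerBoundary G A :=
  mem_outerBoundary.mpr ⟨hw, x, hx, h⟩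

theorem apply_mem_Icc_of_mem_outerBoundary (hf : IsLip G M f) (hv : (M : ℤ) < f v) {w : V}
    (hw : w ∈ outerBoundary G (cluster G M v f)) : f w ∈ Finset.Icc (1 : ℤ) M := by
  obtain ⟨hwA, x, hx, hxw⟩ := mem_outerBoundary.mp hw
  have h1 := lt_of_mem_cluster hv hx
  have h2 := hf x w hxw
  rw [abs_le] at h2
  have h3 : ¬ (M : ℤ) < f w := fun h =>
    hwA (mem_cluster_of_twoStep hx ⟨x, Or.inl rfl, hxw⟩ h)
  rw [Finset.mem_Icc]
  omega

theorem apply_le_of_adj_outerBoundary {w y : V}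
    (hw : w ∈ outerBoundary G (cluster G M v f)) (hy : y ∉ cluster G M v f)
    (h : G.Adj w y) : f y ≤ M := by
  obtain ⟨-, x, hx, hxw⟩ := mem_outerBoundary.mp hw
  by_contra hlt
  exact hy (mem_cluster_of_twoStep hx ⟨w, Or.inr hxw, h⟩ (by omega))

theorem cluster_subset_of_disjoint {g : V → ℤ} {W : Finset V}
    (h : cluster G M v f ⊆ W) (hg : Disjoint (twoStepBoundary G (cluster G M v g)) W) :
    cluster G M v f ⊆ cluster G M v g := by
  intro u hu
  rw [mem_cluster] at hu
  induction hu with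
  | refl => exact self_mem_cluster
  | @tail x y hx hxy ih =>
    by_contra hy
    refine disjoint_left.mp hg (mem_twoStepBoundary.mpr ⟨hy, x, ih, hxy.1⟩) (h ?_)
    exact mem_cluster.mpr (hx.tail hxy)

theorem card_twoStepBoundary_le [DecidableRel G.Adj] {d : ℕ} (hd : ∀ u, G.degree u = d)
    (A : Finset V) : (twoStepBoundary G A).card ≤ 2 * d ^ 2 * A.card := by
  classical
  have hsub : twoStepBoundary G A ⊆ A.biUnion fun x =>
      G.neighborFinset x ∪ (G.neighborFinset x).biUnion fun z => G.neighborFinset z := by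
    intro y hy
    obtain ⟨-, x, hx, z, hz, hzy⟩ := mem_twoStepBoundary.mp hy
    simp only [mem_biUnion, mem_union, SimpleGraph.mem_neighborFinset]
    rcases hz with rfl | hz
    · exact ⟨z, hx, Or.inl hzy⟩
    · exact ⟨x, hx, Or.inr ⟨z, hz, hzy⟩⟩
  refine (card_le_card hsub).trans ?_
  rw [mul_comm]
  refine card_biUnion_le_card_mul _ _ _ fun x _ => (card_union_le _ _).trans ?_
  have h1 : ((G.neighborFinset x).biUnion fun z => G.neighborFinset z).card ≤ d * d := by
    refine (card_biUnion_le_card_mul _ _ d fun z _ => ?_).trans ?_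
    · rw [G.card_neighborFinset_eq_degree, hd]
    · rw [G.card_neighborFinset_eq_degree, hd]
  rw [G.card_neighborFinset_eq_degree, hd]
  nlinarith [Nat.le_self_pow (n := 2) (by norm_num) d]

theorem sum_clusters_le_one [DecidableRel G.Adj] {d : ℕ} (hd : ∀ u, G.degree u = d)
    (hd0 : 0 < d) (𝒜 : Finset (Finset V)) (h𝒜 : ∀ A ∈ 𝒜, ∃ f, cluster G M v f = A) :
    ∑ A ∈ 𝒜, ((1 : ℝ) / (8 * d ^ 2)) ^ A.card ≤ 1 := by
  classical
  have := sum_inv_pow_card_le_one 𝒜 (twoStepBoundary G) (2 * d ^ 2) (by positivity)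
    (fun A _ => disjoint_right.mpr fun x hx => (mem_twoStepBoundary.mp hx).1)
    (fun A _ => card_twoStepBoundary_le hd A) ?_
  · convert this using 3
    push_cast
    ring
  · intro A hA A' hA' W h1 h2 h3 h4
    obtain ⟨f, rfl⟩ := h𝒜 A hA
    obtain ⟨g, rfl⟩ := h𝒜 A' hA'
    exact (cluster_subset_of_disjoint h1 h4).antisymm (cluster_subset_of_disjoint h3 h2)

/-- The ball of radius `t` around `v` lies in the closed neighbourhood of the cluster of `v`
when `f v` exceeds `t M`. -/
theorem gBall_subset_cluster_union [DecidableEq V] (hf : IsLip G M f) {t : ℕ}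
    (hv : (t : ℤ) * M < f v) :
    gBall G v t ⊆ (cluster G M v f ∪ outerBoundary G (cluster G M v f) : Finset V) := by
  have key : ∀ (j : ℕ) (w : V), j < t → ∀ p : G.Walk w v, p.length = j →
      (t - j : ℤ) * M < f w ∧ w ∈ cluster G M v f := by
    intro j
    induction j with
    | zero =>
      intro w _ p hp
      have hwv := SimpleGraph.Walk.eq_of_length_eq_zero hp
      subst hwv
      exact ⟨by simpa using hv, self_mem_cluster⟩
    | succ j ih =>
      intro w hj p hp
      cases p with
      | nil => simp at hp
      | @cons _ x _ hwx q =>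
        obtain ⟨h1, h2⟩ := ih x (by omega) q (by simpa using hp)
        have h3 := hf w x hwx
        rw [abs_le] at h3
        have h4 : (t - (j + 1 : ℕ) : ℤ) * M < f w := by
          push_cast
          linarith
        refine ⟨h4, mem_cluster_of_twoStep h2 ⟨x, Or.inl rfl, hwx.symm⟩ ?_⟩
        have : (1 : ℤ) * M ≤ (t - (j + 1 : ℕ) : ℤ) * M := by
          gcongr
          push_cast
          omega
        linarith
  rintro w ⟨hr, hw⟩
  obtain ⟨p, hp⟩ := hr.symm.exists_walk_length_eq_dist
  rw [SimpleGraph.dist_comm] at hp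
  simp only [coe_union, Set.mem_union, mem_coe]
  cases p with
  | nil => exact Or.inl self_mem_cluster
  | @cons _ x _ hwx q =>
    rw [SimpleGraph.Walk.length_cons] at hp
    have hx := (key q.length x (by omega) q rfl).2
    by_cases hwA : w ∈ cluster G M v f
    · exact Or.inl hwA
    · exact Or.inr (mem_outerBoundary_of_adj hx hwA hwx.symm)

end Cluster

/-- Trading the cluster `A` for extra freedom on its boundary: the functions `f` at level `0`
whose cluster is `A` are rare among the functions at level in `[-M, M]`. -/
theorem card_cluster_eq_mul_le {V : Type*} [Fintype V] {G : SimpleGraph V}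
    (hconn : G.Connected) {M : ℕ} {v : V} (Φ : (V → ℤ) → ℤ)
    (hΦ : ∀ f g : V → ℤ, (∀ u, g u ≠ f u → Φ f ≤ g u ∧ g u ≤ Φ f + M) → |Φ g - Φ f| ≤ M)
    (A : Finset V) (hA : ∃ w, w ∉ A) (S T : Finset (V → ℤ))
    (hS : ∀ f ∈ S, IsLip G M f ∧ Φ f = 0 ∧ (M : ℤ) < f v ∧ cluster G M v f = A)
    (hT : ∀ g, IsLip G M g → |Φ g| ≤ M → g ∈ T) :
    S.card * (M + 1) ^ (outerBoundary G A).card ≤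
      (2 * M + 1) ^ A.card * M ^ (outerBoundary G A).card * T.card := by
  classical
  obtain ⟨w₀, hw₀⟩ := hA
  set B := outerBoundary G A with hB
  have hAB : ∀ w ∈ B, w ∉ A := fun w hw => (mem_outerBoundary.mp hw).1
  set ρ : (V → ℤ) → V → ℤ := fun f u => if u ∈ A ∪ B then 0 else f u with hρ
  have hfib : ∀ r ∈ S.image ρ, {f ∈ S | ρ f = r}.card * (M + 1) ^ B.card ≤
      (2 * M + 1) ^ A.card * M ^ B.card * {g ∈ T | ρ g = r}.card := by
    intro r hr
    obtain ⟨f₀, hf₀, hf₀r⟩ := mem_image.mp hr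
    obtain ⟨hlip, hΦ0, hv, hcl⟩ := hS f₀ hf₀
    have hr_eq : ∀ u, u ∉ A → u ∉ B → r u = f₀ u := by
      intro u h1 h2
      rw [← hf₀r]
      simp [hρ, h1, h2]
    set ok : V → ℤ → Prop := fun w c => ∀ y, y ∉ A → y ∉ B → G.Adj w y → c ≤ r y + M with hok
    set Q : V → Finset ℤ := fun w => {c ∈ Finset.Icc (1 : ℤ) M | ok w c} with hQ
    set Q' : V → Finset ℤ := fun w => {c ∈ Finset.Icc (0 : ℤ) M | ok w c} with hQ'
    have hmemQ : ∀ f ∈ S, ρ f = r → ∀ w ∈ B, f w ∈ Q w := by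
      intro f hf hfr w hw
      obtain ⟨hl, -, hfv, hc⟩ := hS f hf
      simp only [hQ, mem_filter]
      refine ⟨apply_mem_Icc_of_mem_outerBoundary hl hfv (by rw [hc]; exact hw), ?_⟩
      intro y hyA hyB hwy
      have := hl w y hwy
      rw [abs_le] at this
      rw [← hfr]
      simp only [hρ, mem_union, hyA, hyB, or_self, if_false]
      omega
    have hcardQ : ∀ w ∈ B, (Q w).card * (M + 1) ≤ M * (Q' w).card := by
      intro w hw
      have hle : (Q w).card ≤ M := by
        refine (card_filter_le _ _).trans ?_
        simp
      have hlt : (Q w).card + 1 ≤ (Q' w).card := by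
        have h0 : (0 : ℤ) ∉ Q w := by simp [hQ]
        rw [← card_insert_of_notMem h0]
        refine card_le_card fun c hc => ?_
        have hfw := hmemQ f₀ hf₀ hf₀r w hw
        simp only [hQ, hQ', mem_insert, mem_filter, Finset.mem_Icc] at hc hfw ⊢
        rcases hc with rfl | hc
        · refine ⟨⟨le_rfl, by omega⟩, fun y h1 h2 h3 => ?_⟩
          have := hfw.2 y h1 h2 h3
          omega
        · exact ⟨⟨by omega, hc.1.2⟩, hc.2⟩
      nlinarith
    have hprod : (∏ w ∈ B, (Q w).card) * (M + 1) ^ B.card ≤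
        M ^ B.card * ∏ w ∈ B, (Q' w).card := by
      rw [← prod_const, ← prod_const, ← prod_mul_distrib, ← prod_mul_distrib]
      exact prod_le_prod' hcardQ
    set P : (V → Finset ℤ) → Finset (V → ℤ) := fun R =>
      Fintype.piFinset fun u => if u ∈ A then {0} else if u ∈ B then R u else {r u} with hP
    have hcardP : ∀ R, (P R).card = ∏ w ∈ B, (R w).card := by
      intro R
      rw [hP, Fintype.card_piFinset]
      rw [← prod_subset (subset_univ B)]
      · refine prod_congr rfl fun w hw => ?_
        simp [hw, hAB w hw]
      · intro w _ hw
        by_cases hwA : w ∈ A <;> simp [hw, hwA]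
    have hSr : {f ∈ S | ρ f = r}.card ≤ (2 * M + 1) ^ A.card * ∏ w ∈ B, (Q w).card := by
      choose F hFc hF using exists_finset_lip_extensions hconn M w₀ A hw₀
      have hsub : {f ∈ S | ρ f = r} ⊆ (P Q).biUnion F := by
        intro f hf
        rw [mem_filter] at hf
        rw [mem_biUnion]
        refine ⟨fun u => if u ∈ A then 0 else f u, ?_, hF _ f (hS f hf.1).1 ?_⟩
        · rw [hP, Fintype.mem_piFinset]
          intro u
          by_cases huA : u ∈ A
          · simp [huA]
          · by_cases huB : u ∈ B
            · simpa [huA, huB] using hmemQ f hf.1 hf.2 u huB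
            · simp [huA, huB, ← hf.2, hρ]
        · intro u hu
          simp [hu]
      refine (card_le_card hsub).trans ((card_biUnion_le_card_mul _ _ _ fun h _ => hFc h).trans ?_)
      rw [hcardP, mul_comm]
    have hTr : ∏ w ∈ B, (Q' w).card ≤ {g ∈ T | ρ g = r}.card := by
      rw [← hcardP]
      refine card_le_card fun g hg => ?_
      rw [hP, Fintype.mem_piFinset] at hg
      have hgA : ∀ u ∈ A, g u = 0 := fun u hu => by simpa [hu] using hg u
      have hgB : ∀ u ∈ B, g u ∈ Q' u := fun u hu => by simpa [hu, hAB u hu] using hg u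
      have hgU : ∀ u, u ∉ A → u ∉ B → g u = r u := fun u h1 h2 => by
        simpa [h1, h2] using hg u
      have hgB' : ∀ u ∈ B, 0 ≤ g u ∧ g u ≤ M := fun u hu => by
        have := hgB u hu
        simp only [hQ', mem_filter, Finset.mem_Icc] at this
        exact this.1
      have hBU : ∀ w ∈ B, ∀ y, y ∉ A → y ∉ B → G.Adj w y → |g w - g y| ≤ (M : ℤ) := by
        intro w hw y hyA hyB hwy
        have h1 := hgB w hw
        simp only [hQ', mem_filter] at h1
        have h2 := h1.2 y hyA hyB hwy
        have h3 := apply_le_of_adj_outerBoundary (M := M) (v := v) (f := f₀) (w := w) (y := y)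
          (by rw [hcl]; exact hw) (by rw [hcl]; exact hyA) hwy
        rw [← hr_eq y hyA hyB] at h3
        rw [hgU y hyA hyB, abs_le]
        have := hgB' w hw
        omega
      have hlipg : IsLip G M g := by
        intro x y hxy
        by_cases hx : x ∈ A
        · by_cases hy : y ∈ A
          · simp [hgA x hx, hgA y hy]
          · have := hgB' y (mem_outerBoundary_of_adj hx hy hxy)
            rw [hgA x hx, abs_le]
            omega
        · by_cases hy : y ∈ A
          · have := hgB' x (mem_outerBoundary_of_adj hy hx hxy.symm)
            rw [hgA y hy, abs_le]
            omega
          · by_cases hxB : x ∈ B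
            · by_cases hyB : y ∈ B
              · have h1 := hgB' x hxB
                have h2 := hgB' y hyB
                rw [abs_le]
                omega
              · exact hBU x hxB y hy hyB hxy
            · by_cases hyB : y ∈ B
              · rw [abs_sub_comm]
                exact hBU y hyB x hx hxB hxy.symm
              · rw [hgU x hx hxB, hgU y hy hyB, hr_eq x hx hxB, hr_eq y hy hyB]
                exact hlip x y hxy
      rw [mem_filter]
      refine ⟨hT g hlipg ?_, ?_⟩
      · have := hΦ f₀ g fun u hu => ?_
        · rwa [hΦ0, sub_zero] at this
        · rw [hΦ0]
          by_cases huA : u ∈ A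
          · rw [hgA u huA]; omega
          · by_cases huB : u ∈ B
            · have := hgB' u huB
              omega
            · exact absurd ((hgU u huA huB).trans (hr_eq u huA huB)) hu
      · funext u
        simp only [hρ]
        split_ifs with h
        · rw [← hf₀r]; simp only [hρ, if_pos h]
        · rw [mem_union, not_or] at h
          exact hgU u h.1 h.2
    calc _ ≤ (2 * M + 1) ^ A.card * (∏ w ∈ B, (Q w).card) * (M + 1) ^ B.card := by gcongr
      _ = (2 * M + 1) ^ A.card * ((∏ w ∈ B, (Q w).card) * (M + 1) ^ B.card) := by ring
      _ ≤ (2 * M + 1) ^ A.card * (M ^ B.card * ∏ w ∈ B, (Q' w).card) := by gcongr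
      _ ≤ (2 * M + 1) ^ A.card * (M ^ B.card * {g ∈ T | ρ g = r}.card) := by gcongr
      _ = _ := by ring
  calc S.card * (M + 1) ^ B.card
      = ∑ r ∈ S.image ρ, {f ∈ S | ρ f = r}.card * (M + 1) ^ B.card := by
        rw [← sum_mul, ← card_eq_sum_card_image]
    _ ≤ ∑ r ∈ S.image ρ, (2 * M + 1) ^ A.card * M ^ B.card * {g ∈ T | ρ g = r}.card :=
        sum_le_sum hfib
    _ ≤ (2 * M + 1) ^ A.card * M ^ B.card * T.card := by
        rw [← mul_sum]
        gcongr
        rw [← card_biUnion]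
        · exact card_le_card (biUnion_subset.mpr fun r _ => filter_subset _ _)
        · intro r _ r' _ hne
          rw [Function.onFun, disjoint_left]
          intro g hg hg'
          exact hne ((mem_filter.mp hg).2.symm.trans (mem_filter.mp hg').2)

theorem edgeCount_closedNeighborhood {V : Type*} [Fintype V] [DecidableEq V]
    {G : SimpleGraph V} [DecidableRel G.Adj] {d : ℕ} (hd : ∀ u, G.degree u = d)
    (A : Finset V) : edgeCount G A (A ∪ outerBoundary G A) = d * A.card := by
  rw [edgeCount, card_filter, sum_product]
  have : ∀ x ∈ A, (∑ y ∈ A ∪ outerBoundary G A, if G.Adj x y then 1 else 0) = d := by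
    intro x hx
    rw [← card_filter, ← hd x, ← G.card_neighborFinset_eq_degree]
    congr 1
    ext y
    simp only [mem_filter, mem_union, SimpleGraph.mem_neighborFinset, and_iff_right_iff_imp]
    intro hxy
    by_cases hy : y ∈ A
    · exact Or.inl hy
    · exact Or.inr (mem_outerBoundary_of_adj hx hy hxy)
  rw [sum_congr rfl this, sum_const, smul_eq_mul, mul_comm]

/-- Small sets of an expander have large closed neighbourhoods. -/
theorem IsExpander.mul_card_le_card_closedNeighborhood {V : Type*} [Fintype V] [DecidableEq V]
    [Nonempty V] {G : SimpleGraph V} [DecidableRel G.Adj] {d : ℕ} {lam K : ℝ}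
    (hG : IsExpander G d lam) (hd : 0 < d) (hlam : 0 < lam) (hK : 1 ≤ K)
    (hKlam : 2 * K * lam ≤ d) (A : Finset V)
    (hA : (A.card : ℝ) ≤ lam * Fintype.card V / d) :
    K * A.card ≤ ((A ∪ outerBoundary G A).card : ℝ) := by
  have hmix := hG.2 A (A ∪ outerBoundary G A)
  rw [edgeCount_closedNeighborhood hG.1] at hmix
  push_cast at hmix
  set s : ℝ := ((A ∪ outerBoundary G A).card : ℝ)
  set a : ℝ := (A.card : ℝ)
  set n : ℝ := (Fintype.card V : ℝ) with hn
  have hn0 : 0 < n := by rw [hn]; exact_mod_cast Fintype.card_pos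
  have hd0 : (0 : ℝ) < d := by exact_mod_cast hd
  have ha0 : 0 ≤ a := Nat.cast_nonneg _
  have hs0 : 0 ≤ s := Nat.cast_nonneg _
  rw [le_div_iff₀ hd0] at hA
  rcases le_or_gt (n / 2) s with hs | hs
  · refine le_trans ?_ hs
    have h1 : K * (a * d) ≤ K * (lam * n) := by gcongr
    have h2 : 2 * K * lam * n ≤ d * n := by gcongr
    refine le_of_mul_le_mul_right ?_ hd0
    nlinarith
  · rcases ha0.eq_or_lt with ha | ha
    · rw [← ha]; simpa using hs0
    have h1 := (abs_le.mp hmix).2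
    have h2 : (d : ℝ) / n * a * s ≤ d * a / 2 := by
      have : (d : ℝ) / n * a * s ≤ d / n * a * (n / 2) := by gcongr
      refine this.trans (le_of_eq ?_)
      field_simp
    have h3 : d * a / 2 ≤ lam * Real.sqrt (a * s) := by linarith
    have h4 : (d * a / 2) ^ 2 ≤ (lam * Real.sqrt (a * s)) ^ 2 := by gcongr
    rw [mul_pow, Real.sq_sqrt (by positivity)] at h4
    have h5 : d ^ 2 * a ≤ 4 * lam ^ 2 * s := by
      refine le_of_mul_le_mul_right ?_ ha
      nlinarith
    have h6 : (2 * K * lam) ^ 2 ≤ (d : ℝ) ^ 2 := by gcongr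
    have h7 : (2 * K * lam) ^ 2 * a ≤ d ^ 2 * a := by gcongr
    have h8 : K ^ 2 * a ≤ s := by
      refine le_of_mul_le_mul_left ?_ (show (0 : ℝ) < 4 * lam ^ 2 by positivity)
      nlinarith
    have h9 : K * a ≤ K ^ 2 * a := by
      gcongr
      nlinarith
    linarith

/-- The gain on the boundary outweighs both the loss on the cluster and the number of
possible clusters. -/
theorem cluster_weight_bound {M d a b : ℕ} {β : ℝ} (hM : 0 < M) (hd : 0 < d) (ha : 0 < a)
    (hβ : β ≤ (a + b : ℝ))
    (hexp : 16 * ((M : ℝ) + 1) * Real.log (9 * M * d ^ 2) * a ≤ a + b) :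
    ((2 * M + 1 : ℝ)) ^ (a + 1) * (M : ℝ) ^ b ≤
      ((M : ℝ) + 1) ^ b * ((1 / (8 * d ^ 2)) ^ a *
        (1 / 2 * Real.exp (-β / (5 * ((M : ℝ) + 1))))) := by
  have hM1 : (1 : ℝ) ≤ M := by exact_mod_cast hM
  have hd1 : (1 : ℝ) ≤ d := by exact_mod_cast hd
  have hd2 : (1 : ℝ) ≤ (d : ℝ) ^ 2 := one_le_pow₀ hd1
  have ha1 : (1 : ℝ) ≤ a := by exact_mod_cast ha
  set X : ℝ := 9 * M * d ^ 2 with hX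
  have hMd : (1 : ℝ) ≤ M * d ^ 2 := by nlinarith
  have hX9 : 9 ≤ X := by rw [hX]; nlinarith
  have hX0 : 0 < X := by linarith
  have hL : 1 ≤ Real.log X := by
    rw [Real.le_log_iff_exp_le hX0]
    linarith [Real.exp_one_lt_d9]
  set L := Real.log X with hLdef
  have hb : (M : ℝ) ^ b ≤ (M + 1) ^ b * Real.exp (-b / (M + 1)) := by
    have h1 : (M : ℝ) ≤ (M + 1) * Real.exp (-1 / (M + 1)) := by
      have h2 := Real.add_one_le_exp (-1 / ((M : ℝ) + 1))
      calc (M : ℝ) = (M + 1) * (-1 / ((M : ℝ) + 1) + 1) := by field_simp; ring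
        _ ≤ _ := by gcongr
    calc (M : ℝ) ^ b ≤ ((M + 1) * Real.exp (-1 / (M + 1))) ^ b := by gcongr
      _ = _ := by
        rw [mul_pow, ← Real.exp_nat_mul]
        congr 2
        ring
  have hcost : 2 * (2 * M + 1 : ℝ) ^ (a + 1) * (8 * d ^ 2) ^ a ≤ Real.exp (3 * a * L) := by
    have h1 : Real.exp (3 * a * L) = X ^ a * (X ^ 2) ^ a := by
      rw [show 3 * a * L = a * L + (2 * a : ℕ) * L by push_cast; ring, Real.exp_add,
        Real.exp_nat_mul, Real.exp_nat_mul, hLdef, Real.exp_log hX0, pow_mul]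
    have h2 : 2 * (2 * M + 1 : ℝ) ≤ X ^ a := by
      calc 2 * (2 * M + 1 : ℝ) ≤ X := by rw [hX]; nlinarith
        _ ≤ X ^ a := le_self_pow₀ (by linarith) ha.ne'
    have h3 : (2 * M + 1 : ℝ) * (8 * d ^ 2) ≤ X ^ 2 := by
      have : (2 * M + 1 : ℝ) * (8 * d ^ 2) ≤ 3 * M * (8 * d ^ 2) := by gcongr; linarith
      nlinarith
    calc 2 * (2 * M + 1 : ℝ) ^ (a + 1) * (8 * d ^ 2) ^ a
        = 2 * (2 * M + 1 : ℝ) * ((2 * M + 1 : ℝ) * (8 * d ^ 2)) ^ a := by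
          rw [mul_pow _ (8 * (d : ℝ) ^ 2), pow_succ]; ring
      _ ≤ X ^ a * (X ^ 2) ^ a := by gcongr
      _ = _ := h1.symm
  have hexpo : 3 * a * L + -b / (M + 1) ≤ -β / (5 * ((M : ℝ) + 1)) := by
    have h0 : (0 : ℝ) < M + 1 := by linarith
    have h1 : (a : ℝ) ≤ (M + 1) * L * a := by
      have : 1 ≤ ((M : ℝ) + 1) * L := by nlinarith
      nlinarith
    rw [← sub_nonneg]
    have : -β / (5 * ((M : ℝ) + 1)) - (3 * a * L + -b / (M + 1)) =
        (b - β / 5 - 3 * ((M + 1) * L * a)) / (M + 1) := by field_simp; ring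
    rw [this]
    apply div_nonneg _ h0.le
    nlinarith
  have h8 : (0 : ℝ) < 8 * d ^ 2 := by positivity
  have hmain : 2 * (2 * M + 1 : ℝ) ^ (a + 1) * (8 * d ^ 2) ^ a * Real.exp (-b / (M + 1)) ≤
      Real.exp (-β / (5 * ((M : ℝ) + 1))) := by
    calc _ ≤ Real.exp (3 * a * L) * Real.exp (-b / (M + 1)) := by gcongr
      _ = Real.exp (3 * a * L + -b / (M + 1)) := (Real.exp_add _ _).symm
      _ ≤ _ := Real.exp_le_exp.mpr hexpo
  have hmain' : (2 * M + 1 : ℝ) ^ (a + 1) * Real.exp (-b / (M + 1)) ≤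
      (1 / (8 * d ^ 2)) ^ a * (1 / 2 * Real.exp (-β / (5 * ((M : ℝ) + 1)))) := by
    rw [div_pow, one_pow, div_mul_eq_mul_div, one_mul, le_div_iff₀ (by positivity)]
    linarith
  calc ((2 * M + 1 : ℝ)) ^ (a + 1) * (M : ℝ) ^ b
      ≤ (2 * M + 1 : ℝ) ^ (a + 1) * ((M + 1) ^ b * Real.exp (-b / (M + 1))) := by gcongr
    _ = (M + 1) ^ b * ((2 * M + 1 : ℝ) ^ (a + 1) * Real.exp (-b / (M + 1))) := by ring
    _ ≤ _ := by gcongr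

/-- The functions whose level lies in `[-M, M]`, counted against those pinned at `v₀`. -/
theorem exists_finset_lip_level {V : Type*} [Fintype V] {G : SimpleGraph V}
    (hconn : G.Connected) (M : ℕ) (v₀ : V) (Φ : (V → ℤ) → ℤ)
    (hshift : ∀ (f : V → ℤ) (c : ℤ), Φ (fun u => f u + c) = Φ f + c) :
    ∃ T : Finset (V → ℤ), T.card ≤ (2 * M + 1) * (LipSet G v₀ M).ncard ∧
      ∀ g, IsLip G M g → |Φ g| ≤ M → g ∈ T := by
  classical
  have hfin := finite_lipSet hconn v₀ M
  refine ⟨(Finset.Icc (-M : ℤ) M ×ˢ hfin.toFinset).image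
    fun p => fun u => p.2 u + (p.1 - Φ p.2), ?_, ?_⟩
  · refine card_image_le.trans ?_
    rw [card_product, Int.card_Icc, Set.ncard_eq_toFinset_card _ hfin]
    gcongr
    omega
  · intro g hg hΦg
    rw [mem_image]
    refine ⟨(Φ g, fun u => g u + -g v₀), ?_, ?_⟩
    · rw [mem_product]
      refine ⟨?_, ?_⟩
      · rw [Finset.mem_Icc]
        exact abs_le.mp hΦg
      · rw [Set.Finite.mem_toFinset]
        exact ⟨by ring, hg.add_const _⟩
    · funext u
      simp only [hshift]
      ring

theorem ncard_above_level_le {V : Type*} [Fintype V] {G : SimpleGraph V} [DecidableRel G.Adj]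
    {d M : ℕ} {lam : ℝ} (hM : 0 < M) (hd : 0 < d) (hconn : G.Connected)
    (hG : IsExpander G d lam) (hlam0 : 0 < lam)
    (hlam : lam ≤ (d : ℝ) / (32 * ((M : ℝ) + 1) * Real.log (9 * M * d ^ 2)))
    (v₀ : V) (Φ : (V → ℤ) → ℤ)
    (hshift : ∀ (f : V → ℤ) (c : ℤ), Φ (fun u => f u + c) = Φ f + c)
    (hsmall : ∀ f, IsLip G M f →
      (({u | Φ f + M < f u} : Finset V).card : ℝ) ≤ lam * Fintype.card V / d)
    (hΦ : ∀ f g : V → ℤ, (∀ u, g u ≠ f u → Φ f ≤ g u ∧ g u ≤ Φ f + M) → |Φ g - Φ f| ≤ M)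
    (v : V) (t : ℕ) (ht : 1 ≤ t) :
    ({f ∈ LipSet G v₀ M | Φ f + t * M < f v}.ncard : ℝ) ≤
      1 / 2 * Real.exp (-((gBall G v t).ncard : ℝ) / (5 * ((M : ℝ) + 1))) *
        ((LipSet G v₀ M).ncard : ℝ) := by
  classical
  have : Nonempty V := ⟨v₀⟩
  have hM1 : (1 : ℝ) ≤ M := by exact_mod_cast hM
  have hd1 : (1 : ℝ) ≤ d := by exact_mod_cast hd
  have hL : 1 ≤ Real.log (9 * M * d ^ 2) := by
    have : (1 : ℝ) ≤ M * d ^ 2 := one_le_mul_of_one_le_of_one_le hM1 (one_le_pow₀ hd1)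
    rw [Real.le_log_iff_exp_le (by positivity)]
    linarith [Real.exp_one_lt_d9]
  set K : ℝ := 16 * ((M : ℝ) + 1) * Real.log (9 * M * d ^ 2) with hK
  have hK1 : 1 ≤ K := by
    have : 1 ≤ ((M : ℝ) + 1) * Real.log (9 * M * d ^ 2) :=
      one_le_mul_of_one_le_of_one_le (by linarith) hL
    rw [hK]
    linarith
  have hKlam : 2 * K * lam ≤ d := by
    rw [show 32 * ((M : ℝ) + 1) * Real.log (9 * M * d ^ 2) = 2 * K by rw [hK]; ring,
      le_div_iff₀ (by linarith)] at hlam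
    linarith
  have hMt : (M : ℤ) ≤ t * M := by
    have : (1 : ℤ) ≤ t := by exact_mod_cast ht
    nlinarith
  obtain ⟨T, hTcard, hT⟩ := exists_finset_lip_level hconn M v₀ Φ hshift
  set S : Finset (V → ℤ) := {f ∈ T | IsLip G M f ∧ Φ f = 0 ∧ t * M < f v} with hS
  have hES : {f ∈ LipSet G v₀ M | Φ f + t * M < f v}.ncard ≤ S.card := by
    rw [← Set.ncard_coe_finset]
    refine Set.ncard_le_ncard_of_injOn (fun f u => f u + -Φ f) ?_ ?_ S.finite_toSet
    · rintro f ⟨hf, hfv⟩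
      have hl : IsLip G M fun u => f u + -Φ f := IsLip.add_const hf.2 _
      have h0 : Φ (fun u => f u + -Φ f) = 0 := by rw [hshift]; ring
      simp only [hS, coe_filter, Set.mem_ofPred_eq]
      exact ⟨hT _ hl (by rw [h0]; simp), hl, h0, by linarith⟩
    · rintro f ⟨hf, -⟩ g ⟨hg, -⟩ hfg
      have h0 := congrFun hfg v₀
      simp only [hf.1, hg.1] at h0
      funext u
      have hu := congrFun hfg u
      simp only at hu
      linarith
  set N : ℝ := ((LipSet G v₀ M).ncard : ℝ)
  set ε : ℝ := 1 / 2 * Real.exp (-((gBall G v t).ncard : ℝ) / (5 * ((M : ℝ) + 1)))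
  have hfiber : ∀ A ∈ S.image (cluster G M v),
      (({f ∈ S | cluster G M v f = A} : Finset _).card : ℝ) ≤
        (1 / (8 * d ^ 2)) ^ A.card * (ε * N) := by
    intro A hA
    obtain ⟨f, hf, rfl⟩ := mem_image.mp hA
    simp only [hS, mem_filter] at hf
    obtain ⟨-, hlip, hf0, hfv⟩ := hf
    set A := cluster G M v f with hAdef
    have hAsmall : (A.card : ℝ) ≤ lam * Fintype.card V / d := by
      refine le_trans ?_ (hsmall f hlip)
      norm_cast
      refine card_le_card fun u hu => ?_
      have := lt_of_mem_cluster (hMt.trans_lt hfv) hu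
      simp only [mem_filter, mem_univ, true_and]
      omega
    have hAne : ∃ w, w ∉ A := by
      by_contra! hall
      have hAu : A = univ := eq_univ_iff_forall.mpr hall
      have hn : (0 : ℝ) < Fintype.card V := by exact_mod_cast Fintype.card_pos
      rw [hAu, card_univ, le_div_iff₀ (by linarith)] at hAsmall
      have h1 : (d : ℝ) ≤ lam := by
        refine le_of_mul_le_mul_left ?_ hn
        linarith
      nlinarith
    have hcount := card_cluster_eq_mul_le hconn Φ hΦ A hAne
      {f ∈ S | cluster G M v f = A} T (v := v) (fun g hg => by
        simp only [hS, mem_filter] at hg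
        exact ⟨hg.1.2.1, hg.1.2.2.1, hMt.trans_lt hg.1.2.2.2, hg.2⟩) hT
    have hexp := hG.mul_card_le_card_closedNeighborhood hd hlam0 hK1 hKlam A hAsmall
    have hball : ((gBall G v t).ncard : ℝ) ≤ ((A ∪ outerBoundary G A).card : ℝ) := by
      norm_cast
      rw [← Set.ncard_coe_finset]
      exact Set.ncard_le_ncard (gBall_subset_cluster_union hlip hfv) (finite_toSet _)
    have hcardN : (A ∪ outerBoundary G A).card = A.card + (outerBoundary G A).card :=
      card_union_of_disjoint (disjoint_right.mpr fun x hx => (mem_outerBoundary.mp hx).1)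
    rw [hcardN] at hexp hball
    push_cast at hexp hball
    have hwt := cluster_weight_bound hM hd (card_pos.mpr ⟨v, self_mem_cluster⟩) hball hexp
    set b := (outerBoundary G A).card
    have hcount' : (({f ∈ S | cluster G M v f = A} : Finset _).card : ℝ) * ((M : ℝ) + 1) ^ b ≤
        (2 * M + 1) ^ A.card * M ^ b * ((2 * M + 1) * N) := by
      have h1 : (({f ∈ S | cluster G M v f = A} : Finset _).card : ℝ) * ((M : ℝ) + 1) ^ b ≤
        (2 * M + 1) ^ A.card * M ^ b * T.card := by exact_mod_cast hcount
      have h2 : (T.card : ℝ) ≤ (2 * M + 1) * N := by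
        simp only [N]
        exact_mod_cast hTcard
      refine h1.trans ?_
      gcongr
    have hN0 : 0 ≤ N := Nat.cast_nonneg _
    refine le_of_mul_le_mul_right ?_ (show (0 : ℝ) < ((M : ℝ) + 1) ^ b by positivity)
    calc _ ≤ (2 * M + 1 : ℝ) ^ A.card * M ^ b * ((2 * M + 1) * N) := hcount'
      _ = ((2 * M + 1 : ℝ) ^ (A.card + 1) * M ^ b) * N := by ring
      _ ≤ (((M : ℝ) + 1) ^ b * ((1 / (8 * d ^ 2)) ^ A.card * ε)) * N := by gcongr
      _ = _ := by ring
  calc ({f ∈ LipSet G v₀ M | Φ f + t * M < f v}.ncard : ℝ) ≤ S.card := by exact_mod_cast hES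
    _ = ∑ A ∈ S.image (cluster G M v),
          (({f ∈ S | cluster G M v f = A} : Finset _).card : ℝ) := by
        rw [card_eq_sum_card_image (cluster G M v) S]
        push_cast
        rfl
    _ ≤ ∑ A ∈ S.image (cluster G M v), (1 / (8 * d ^ 2) : ℝ) ^ A.card * (ε * N) :=
        sum_le_sum hfiber
    _ ≤ 1 * (ε * N) := by
        rw [← sum_mul]
        gcongr
        refine sum_clusters_le_one (M := M) (v := v) hG.1 hd _ fun A hA => ?_
        obtain ⟨f, -, hf⟩ := mem_image.mp hA
        exact ⟨f, hf⟩
    _ = ε * N := one_mul _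

/-- The least `j` such that more than `θ` vertices satisfy `f ≤ j`. -/
theorem exists_level {V : Type*} [Fintype V] (θ : ℝ) (h0 : 0 ≤ θ)
    (hθ : θ < Fintype.card V) :
    ∃ Φ : (V → ℤ) → ℤ, ∀ (f : V → ℤ) (j : ℤ),
      Φ f ≤ j ↔ θ < (({u | f u ≤ j} : Finset V).card : ℝ) := by
  have key : ∀ f : V → ℤ, ∃ k : ℤ, ∀ j : ℤ,
      k ≤ j ↔ θ < (({u | f u ≤ j} : Finset V).card : ℝ) := by
    intro f
    obtain ⟨hi, hhi⟩ := (Set.finite_range f).bddAbove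
    obtain ⟨lo, hlo⟩ := (Set.finite_range f).bddBelow
    obtain ⟨k, hk, hmin⟩ := Int.exists_least_of_bdd
      (P := fun j => θ < (({u | f u ≤ j} : Finset V).card : ℝ))
      ⟨lo, fun j hj => by
        have hpos : (0 : ℝ) < (({u | f u ≤ j} : Finset V).card : ℝ) := h0.trans_lt hj
        obtain ⟨u, hu⟩ := card_pos.mp (by exact_mod_cast hpos)
        exact (hlo ⟨u, rfl⟩).trans (mem_filter.mp hu).2⟩
      ⟨hi, by
        have : ({u | f u ≤ hi} : Finset V) = univ :=
          filter_true_of_mem fun u _ => hhi ⟨u, rfl⟩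
        rwa [this, card_univ]⟩
    refine ⟨k, fun j => ⟨fun hkj => hk.trans_le ?_, hmin j⟩⟩
    norm_cast
    exact card_le_card (monotone_filter_right _ fun u _ hu => le_trans hu hkj)
  choose Φ hΦ using key
  exact ⟨Φ, hΦ⟩

/-- In an expander, two sets with no edges between them cannot both be large. -/
theorem IsExpander.card_le_of_no_edges {V : Type*} [Fintype V] [Nonempty V]
    {G : SimpleGraph V} [DecidableRel G.Adj] {d : ℕ} {lam : ℝ} (hG : IsExpander G d lam)
    (hd : 0 < d) (hlam : 0 < lam) {S T : Finset V} (h : ∀ x ∈ S, ∀ y ∈ T, ¬ G.Adj x y)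
    (hS : lam * Fintype.card V / d < S.card) : (T.card : ℝ) ≤ lam * Fintype.card V / d := by
  have hmix := hG.2 S T
  have h0 : edgeCount G S T = 0 := by
    rw [edgeCount, card_eq_zero, filter_eq_empty_iff]
    rintro ⟨x, y⟩ hxy
    rw [mem_product] at hxy
    exact h x hxy.1 y hxy.2
  rw [h0, Nat.cast_zero, zero_sub, abs_neg] at hmix
  have hmix := (le_abs_self _).trans hmix
  have hd0 : (0 : ℝ) < d := by exact_mod_cast hd
  have hn0 : (0 : ℝ) < Fintype.card V := by exact_mod_cast Fintype.card_pos
  set n : ℝ := (Fintype.card V : ℝ)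
  set θ : ℝ := lam * n / d with hθ
  have hθ0 : 0 < θ := by positivity
  by_contra! hT
  set q : ℝ := Real.sqrt ((S.card : ℝ) * T.card) with hq
  have hST : θ ^ 2 < (S.card : ℝ) * T.card := by nlinarith
  have hqθ : θ < q := Real.lt_sqrt_of_sq_lt hST
  have hqq : q * q = (S.card : ℝ) * T.card := Real.mul_self_sqrt (by positivity)
  have hle : (d : ℝ) / n * (q * q) ≤ lam * q := by rw [hqq]; linarith
  have hlt : lam * q < d / n * (q * q) := by
    have : d / n * θ = lam := by rw [hθ]; field_simp
    calc lam * q = d / n * θ * q := by rw [this]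
      _ < d / n * q * q := by
        have : 0 < q := hθ0.trans hqθ
        gcongr
      _ = _ := by ring
  linarith

theorem stmt1 {V : Type*} [Fintype V] (G : SimpleGraph V) [DecidableRel G.Adj]
    (d M : ℕ) (lam : ℝ) (hM : 0 < M) (hconn : G.Connected)
    (hG : IsExpander G d lam)
    (hlam : lam ≤ (d : ℝ) / (32 * ((M : ℝ) + 1) * Real.log (9 * M * d ^ 2)))
    (v₀ : V) :
    ∃ Φ : (V → ℤ) → ℤ,
      (∀ f ∈ LipSet G v₀ M,
        ({v : V | f v ∉ Set.Icc (Φ f) (Φ f + M)}.ncard : ℝ) ≤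
          2 * lam * (Fintype.card V : ℝ) / d) ∧
      ∀ (v : V) (t : ℕ), 1 ≤ t →
        ({f ∈ LipSet G v₀ M |
            ∀ a ∈ Set.Icc (Φ f) (Φ f + (M : ℤ)), ((t : ℤ) - 1) * M < |f v - a|}.ncard : ℝ) ≤
          Real.exp (-((gBall G v t).ncard : ℝ) / (5 * ((M : ℝ) + 1))) *
            ((LipSet G v₀ M).ncard : ℝ) := by
  have : Nonempty V := ⟨v₀⟩
  rcases Nat.eq_zero_or_pos d with rfl | hd
  · have hall : ∀ f ∈ LipSet G v₀ M, ∀ v, f v = 0 := by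
      intro f hf v
      suffices v = v₀ by rw [this, hf.1]
      by_contra hne
      obtain ⟨x, -, y, -, hxy⟩ := hconn.exists_adj_mem_notMem (A := {v₀})
        (Finset.singleton_nonempty _) (w := v) (by simpa using hne)
      have := (G.degree_pos_iff_exists_adj x).mpr ⟨y, hxy⟩
      rw [hG.1 x] at this
      exact lt_irrefl _ this
    refine ⟨fun _ => 0, fun f hf => ?_, fun v t ht => ?_⟩
    · have : {v : V | f v ∉ Set.Icc (0 : ℤ) (0 + M)} = ∅ := by
        ext v
        simp [hall f hf v]
      rw [this]
      simp
    · have : {f ∈ LipSet G v₀ M |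
          ∀ a ∈ Set.Icc (0 : ℤ) (0 + (M : ℤ)), ((t : ℤ) - 1) * M < |f v - a|} = ∅ := by
        rw [Set.eq_empty_iff_forall_notMem]
        rintro f ⟨hf, h⟩
        have h1 := h 0 (by simp)
        rw [hall f hf v, sub_zero, abs_zero] at h1
        have h2 : (0 : ℤ) ≤ (t : ℤ) - 1 := by omega
        exact absurd h1 (not_lt.mpr (by positivity))
      rw [this, Set.ncard_empty, Nat.cast_zero]
      positivity
  have hd1 : (1 : ℝ) ≤ d := by exact_mod_cast hd
  have hM1 : (1 : ℝ) ≤ M := by exact_mod_cast hM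
  have hn0 : (0 : ℝ) < Fintype.card V := by exact_mod_cast Fintype.card_pos
  have hlam0 : 0 < lam := by
    have h := (le_abs_self _).trans ((abs_sub_comm _ _).trans_le (hG.2 {v₀} {v₀}))
    simp only [edgeCount, Finset.singleton_product_singleton, Finset.filter_singleton,
      G.irrefl, if_false, Finset.card_empty, Nat.cast_zero, Finset.card_singleton,
      Nat.cast_one, mul_one, Real.sqrt_one, sub_zero] at h
    exact lt_of_lt_of_le (by positivity) h
  have hL : 1 ≤ Real.log (9 * M * d ^ 2) := by
    have : (1 : ℝ) ≤ M * d ^ 2 := one_le_mul_of_one_le_of_one_le hM1 (one_le_pow₀ hd1)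
    rw [Real.le_log_iff_exp_le (by positivity)]
    linarith [Real.exp_one_lt_d9]
  have hlamd : lam < d := by
    refine hlam.trans_lt (div_lt_self (by linarith) ?_)
    nlinarith
  set θ : ℝ := lam * Fintype.card V / d with hθ
  have hθ0 : 0 ≤ θ := by positivity
  have hθn : θ < Fintype.card V := by
    rw [hθ, div_lt_iff₀ (by linarith), mul_comm]
    gcongr
  obtain ⟨Φ, hΦ⟩ := exists_level (V := V) θ hθ0 hθn
  have hshift : ∀ (f : V → ℤ) (c : ℤ), Φ (fun u => f u + c) = Φ f + c := by
    intro f c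
    refine eq_of_forall_ge_iff fun j => ?_
    rw [hΦ, ← le_sub_iff_add_le, hΦ]
    simp only [le_sub_iff_add_le]
  have hbelow : ∀ f : V → ℤ, ((({u | f u < Φ f} : Finset V)).card : ℝ) ≤ θ := by
    intro f
    have h := (hΦ f (Φ f - 1)).not.mp (by omega)
    simpa only [Int.le_sub_one_iff, not_lt] using h
  have habove : ∀ f, IsLip G M f →
      ((({u | Φ f + M < f u} : Finset V)).card : ℝ) ≤ θ := by
    intro f hf
    refine hG.card_le_of_no_edges hd hlam0 ?_ ((hΦ f (Φ f)).mp le_rfl)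
    intro x hx y hy hxy
    simp only [mem_filter, mem_univ, true_and] at hx hy
    have := hf x y hxy
    rw [abs_le] at this
    omega
  have hstable : ∀ f g : V → ℤ, (∀ u, g u ≠ f u → Φ f ≤ g u ∧ g u ≤ Φ f + M) →
      Φ f ≤ Φ g ∧ Φ g ≤ Φ f + M := by
    intro f g hfg
    constructor
    · by_contra! hlt
      have h1 := (hΦ g (Φ g)).mp le_rfl
      refine absurd (hbelow f) (not_le.mpr (h1.trans_le ?_))
      norm_cast
      refine card_le_card (monotone_filter_right _ fun u _ hu => ?_)
      have := hfg u
      omega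
    · rw [hΦ]
      refine ((hΦ f (Φ f)).mp le_rfl).trans_le ?_
      norm_cast
      refine card_le_card (monotone_filter_right _ fun u _ hu => ?_)
      have := hfg u
      omega
  refine ⟨Φ, fun f hf => ?_, fun v t ht => ?_⟩
  · classical
    have hsub : {v : V | f v ∉ Set.Icc (Φ f) (Φ f + M)} ⊆
        (({u | f u < Φ f} : Finset V) ∪ ({u | Φ f + M < f u} : Finset V) : Finset V) := by
      intro v hv
      simp only [Set.mem_ofPred_eq, Set.mem_Icc, not_and_or, not_le] at hv
      simpa using hv
    have h1 := Set.ncard_le_ncard hsub (Finset.finite_toSet _)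
    rw [Set.ncard_coe_finset] at h1
    have h2 := h1.trans (card_union_le _ _)
    have h3 : ({v : V | f v ∉ Set.Icc (Φ f) (Φ f + M)}.ncard : ℝ) ≤
        (({u | f u < Φ f} : Finset V).card : ℝ) +
          (({u | Φ f + M < f u} : Finset V).card : ℝ) := by exact_mod_cast h2
    refine h3.trans ((add_le_add (hbelow f) (habove f hf.2)).trans (le_of_eq ?_))
    rw [hθ]
    ring
  · have hup := ncard_above_level_le hM hd hconn hG hlam0 hlam v₀ Φ hshift habove
      (fun f g h => abs_le.mpr (by have := hstable f g h; omega)) v t ht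
    have hdown := ncard_above_level_le hM hd hconn hG hlam0 hlam v₀
      (fun f => -Φ (fun u => -f u) - M)
      (fun f c => by
        have := hshift (fun u => -f u) (-c)
        simp only [neg_add]
        rw [this]
        ring)
      (fun f hf => by
        refine le_trans (le_of_eq ?_) (hbelow fun u => -f u)
        congr 2
        ext u
        simp only [mem_filter, mem_univ, true_and]
        omega)
      (fun f g h => abs_le.mpr (by
        have := hstable (fun u => -f u) (fun u => -g u) fun u hu => by
          have := h u fun h' => hu (by rw [h'])
          omega
        omega)) v t ht
    have hfin := finite_lipSet hconn v₀ M
    set E₁ := {f ∈ LipSet G v₀ M | Φ f + t * M < f v}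
    set E₂ := {f ∈ LipSet G v₀ M | (-Φ (fun u => -f u) - M) + t * M < f v}
    have hsub : {f ∈ LipSet G v₀ M |
        ∀ a ∈ Set.Icc (Φ f) (Φ f + (M : ℤ)), ((t : ℤ) - 1) * M < |f v - a|} ⊆
        E₁ ∪ (fun f u => -f u) '' E₂ := by
      rintro f ⟨hf, h⟩
      have ht0 : (0 : ℤ) ≤ ((t : ℤ) - 1) * M := by
        have : (0 : ℤ) ≤ (t : ℤ) - 1 := by omega
        positivity
      rw [sub_mul, one_mul] at h ht0
      rcases lt_or_ge (f v) (Φ f) with h1 | h1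
      · right
        have h2 := h (Φ f) ⟨le_rfl, by omega⟩
        rw [abs_of_neg (by omega)] at h2
        refine ⟨fun u => -f u, ⟨⟨by simp [hf.1], IsLip.neg hf.2⟩, ?_⟩, by simp⟩
        simp only [neg_neg]
        change -Φ f - M + t * M < -f v
        omega
      · rcases le_or_gt (f v) (Φ f + M) with h3 | h3
        · have h2 := h (f v) ⟨h1, h3⟩
          simp only [sub_self, abs_zero] at h2
          omega
        · left
          have h2 := h (Φ f + M) ⟨by omega, le_rfl⟩
          rw [abs_of_pos (by omega)] at h2
          exact ⟨hf, by omega⟩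
    have hE₁ : E₁.Finite := hfin.subset fun f hf => hf.1
    have hE₂ : E₂.Finite := hfin.subset fun f hf => hf.1
    have hcard := (Set.ncard_le_ncard hsub (hE₁.union (hE₂.image _))).trans
      ((Set.ncard_union_le _ _).trans
        (Nat.add_le_add_left (Set.ncard_image_le hE₂) _))
    have hcard' : ({f ∈ LipSet G v₀ M | ∀ a ∈ Set.Icc (Φ f) (Φ f + (M : ℤ)),
        ((t : ℤ) - 1) * M < |f v - a|}.ncard : ℝ) ≤ E₁.ncard + E₂.ncard := by
      exact_mod_cast hcard
    linarith
end

section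
/- Let G be a 2n-vertex d-regular λ-bi-expander with color classes V₀ and V₁, with λ < d/3, and let v₀ be a vertex of G. Then for every f ∈ Hom_{v₀}(G) there exist i ∈ {0,1} and an integer k such that the number of vertices v ∈ V_i with f(v) ≠ k is at most 2λn/d and, in addition, the number of vertices v ∈ V(G) with |f(v) − k| ≥ 2 is at most 3λn/d. -/
/-- `G` is a `d`-regular `λ`-bi-expander with `2n` vertices and color classes `V0`, `V1`. -/
def IsBiExpander {V : Type*} [Fintype V] (G : SimpleGraph V) [DecidableRel G.Adj]
    (V0 V1 : Finset V) (n d : ℕ) (lam : ℝ) : Prop :=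
  Fintype.card V = 2 * n ∧ V0.card = n ∧ V1.card = n ∧
  (∀ v : V, v ∈ V0 ∨ v ∈ V1) ∧ Disjoint V0 V1 ∧
  (∀ u v : V, G.Adj u v → (u ∈ V0 ∧ v ∈ V1) ∨ (u ∈ V1 ∧ v ∈ V0)) ∧
  (∀ v : V, G.degree v = d) ∧
  ∀ S T : Finset V, S ⊆ V0 → T ⊆ V1 →
    |(edgeCount G S T : ℝ) - (d : ℝ) / (n : ℝ) * S.card * T.card| ≤
      lam * Real.sqrt ((S.card : ℝ) * T.card)

/-- Graph homomorphisms from `G` to `ℤ` vanishing at `v₀`. -/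
def HomSet {V : Type*} (G : SimpleGraph V) (v₀ : V) : Set (V → ℤ) :=
  {f | f v₀ = 0 ∧ ∀ u v : V, G.Adj u v → |f u - f v| = 1}

section LevelSets

variable {V : Type*} [Fintype V] (f : V → ℤ)

/-- The vertices at height at most `j` whose height has the parity of `j`. -/
def lowerLevels (j : ℤ) : Finset V := Finset.univ.filter fun v => f v ≤ j ∧ 2 ∣ f v - j

/-- The vertices at height at least `j` whose height has the parity of `j`. -/
def upperLevels (j : ℤ) : Finset V := Finset.univ.filter fun v => j ≤ f v ∧ 2 ∣ f v - j

lemma card_lowerLevels_add_card_upperLevels (j : ℤ) :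
    (lowerLevels f j).card + (upperLevels f (j + 2)).card =
      (Finset.univ.filter fun v => 2 ∣ f v - j).card := by
  classical
  rw [← Finset.card_union_of_disjoint]
  · congr 1
    ext v
    simp only [lowerLevels, upperLevels, Finset.mem_union, Finset.mem_filter, Finset.mem_univ,
      true_and]
    omega
  · rw [Finset.disjoint_left]
    intro v
    simp only [lowerLevels, upperLevels, Finset.mem_filter, Finset.mem_univ, true_and]
    omega

lemma exists_card_lowerLevels_le_lt {n : ℕ} {μ : ℝ} (hμ : 0 ≤ μ) (hμn : μ < n)
    (hcard : ∀ j : ℤ, (Finset.univ.filter fun v => 2 ∣ f v - j).card = n) :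
    ∃ j : ℤ, ((lowerLevels f j).card : ℝ) ≤ μ ∧ μ < (lowerLevels f (j + 1)).card := by
  by_contra! hstep
  obtain ⟨M, hM⟩ : ∃ M : ℤ, ∀ v, f v ≤ M := by
    obtain ⟨M, hM⟩ := (Set.finite_range f).bddAbove
    exact ⟨M, fun v => hM ⟨v, rfl⟩⟩
  obtain ⟨m, hm⟩ : ∃ m : ℤ, ∀ v, m ≤ f v := by
    obtain ⟨m, hm⟩ := (Set.finite_range f).bddBelow
    exact ⟨m, fun v => hm ⟨v, rfl⟩⟩
  have hbase : ((lowerLevels f (m - 1)).card : ℝ) ≤ μ := by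
    have : lowerLevels f (m - 1) = ∅ := by
      apply Finset.filter_eq_empty_iff.2
      intro v _
      have := hm v
      omega
    simpa [this] using hμ
  have hall : ∀ j, m - 1 ≤ j → ((lowerLevels f j).card : ℝ) ≤ μ :=
    Int.leInduction hbase fun j _ hj => hstep j hj
  have htop : (lowerLevels f (max M m)).card = n := by
    rw [← hcard (max M m)]
    congr 1
    ext v
    simp [lowerLevels, hM v]
  have := hall (max M m) (by omega)
  rw [htop] at this
  linarith

lemma exists_concentrated_level {n : ℕ} {μ : ℝ} (hμ : 0 ≤ μ) (hμn : 3 * μ < n)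
    (hcard : ∀ j : ℤ, (Finset.univ.filter fun v => 2 ∣ f v - j).card = n)
    (hexp : ∀ j : ℤ, ((lowerLevels f j).card : ℝ) * (upperLevels f (j + 3)).card ≤ μ ^ 2) :
    ∃ k : ℤ, ((Finset.univ.filter fun v => 2 ∣ f v - k ∧ f v ≠ k).card : ℝ) ≤ 2 * μ ∧
      ((Finset.univ.filter fun v => 2 ≤ |f v - k|).card : ℝ) ≤ 3 * μ := by
  classical
  have hsum (j : ℤ) :
      ((lowerLevels f j).card : ℝ) + (upperLevels f (j + 2)).card = n := by
    exact_mod_cast (card_lowerLevels_add_card_upperLevels f j).trans (hcard j)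
  obtain ⟨j, hj, hj'⟩ := exists_card_lowerLevels_le_lt f hμ (by linarith) hcard
  have hU : ((upperLevels f (j + 4)).card : ℝ) ≤ μ := by
    have h := hexp (j + 1)
    rw [show j + 1 + 3 = j + 4 by ring] at h
    by_contra! hlt
    nlinarith
  have hL : 2 * ((lowerLevels f (j - 1)).card : ℝ) ≤ μ := by
    have h := hexp (j - 1)
    rw [show j - 1 + 3 = j + 2 by ring] at h
    have := hsum j
    by_contra! hlt
    nlinarith
  have hU' : 2 * ((upperLevels f (j + 5)).card : ℝ) ≤ μ := by
    have h := hexp (j + 2)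
    have := hsum (j + 2)
    rw [show j + 2 + 3 = j + 5 by ring] at h
    rw [show j + 2 + 2 = j + 4 by ring] at this
    by_contra! hlt
    nlinarith
  refine ⟨j + 2, ?_, ?_⟩
  · have hsub : (Finset.univ.filter fun v => 2 ∣ f v - (j + 2) ∧ f v ≠ j + 2) ⊆
        lowerLevels f j ∪ upperLevels f (j + 4) := by
      intro v
      simp only [lowerLevels, upperLevels, Finset.mem_union, Finset.mem_filter, Finset.mem_univ,
        true_and]
      omega
    have h : ((Finset.univ.filter fun v => 2 ∣ f v - (j + 2) ∧ f v ≠ j + 2).card : ℝ) ≤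
        (lowerLevels f j).card + (upperLevels f (j + 4)).card := by
      exact_mod_cast (Finset.card_le_card hsub).trans (Finset.card_union_le _ _)
    linarith
  · have hsub : (Finset.univ.filter fun v => 2 ≤ |f v - (j + 2)|) ⊆
        (lowerLevels f j ∪ upperLevels f (j + 4)) ∪
          (lowerLevels f (j - 1) ∪ upperLevels f (j + 5)) := by
      intro v
      simp only [lowerLevels, upperLevels, Finset.mem_union, Finset.mem_filter, Finset.mem_univ,
        true_and, le_abs]
      omega
    have h : ((Finset.univ.filter fun v => 2 ≤ |f v - (j + 2)|).card : ℝ) ≤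
        ((lowerLevels f j).card + (upperLevels f (j + 4)).card) +
          ((lowerLevels f (j - 1)).card + (upperLevels f (j + 5)).card) := by
      exact_mod_cast (Finset.card_le_card hsub).trans <| (Finset.card_union_le _ _).trans <|
        add_le_add (Finset.card_union_le _ _) (Finset.card_union_le _ _)
    linarith

end LevelSets

section EdgeCount

variable {V : Type*} (G : SimpleGraph V) [DecidableRel G.Adj]

lemma edgeCount_comm (S T : Finset V) : edgeCount G S T = edgeCount G T S := by
  simp only [edgeCount, Finset.card_filter, Finset.sum_product]
  rw [Finset.sum_comm]
  simp only [G.adj_comm]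

lemma edgeCount_eq_zero {S T : Finset V} (h : ∀ u ∈ S, ∀ v ∈ T, ¬ G.Adj u v) :
    edgeCount G S T = 0 := by
  rw [edgeCount, Finset.card_eq_zero, Finset.filter_eq_empty_iff]
  rintro ⟨u, v⟩ huv
  rw [Finset.mem_product] at huv
  exact h u huv.1 v huv.2

lemma edgeCount_eq_mul_card [Fintype V] {d : ℕ} (hd : ∀ v, G.degree v = d) {S T : Finset V}
    (h : ∀ u ∈ S, ∀ v, G.Adj u v → v ∈ T) : edgeCount G S T = d * S.card := by
  rw [edgeCount, Finset.card_filter, Finset.sum_product, mul_comm, ← smul_eq_mul]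
  apply Finset.sum_eq_card_nsmul
  intro u hu
  rw [← hd u, ← Finset.card_filter, ← G.card_neighborFinset_eq_degree]
  congr 1
  ext v
  simpa using h u hu v

end EdgeCount

namespace IsBiExpander

variable {V : Type*} [Fintype V] {G : SimpleGraph V} [DecidableRel G.Adj]
  {V0 V1 : Finset V} {n d : ℕ} {lam : ℝ}

lemma symm (hG : IsBiExpander G V0 V1 n d lam) : IsBiExpander G V1 V0 n d lam := by
  obtain ⟨hV, h0, h1, hcover, hdisj, hadj, hdeg, hexp⟩ := hG
  refine ⟨hV, h1, h0, fun v => (hcover v).symm, hdisj.symm, fun u v huv => (hadj u v huv).symm,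
    hdeg, fun S T hS hT => ?_⟩
  have := hexp T S hT hS
  rwa [edgeCount_comm, mul_right_comm, mul_comm (T.card : ℝ)] at this

lemma card_pos (hG : IsBiExpander G V0 V1 n d lam) (v : V) : 0 < n := by
  have := Fintype.card_pos_iff.2 ⟨v⟩
  have := hG.1
  omega

lemma lam_nonneg (hG : IsBiExpander G V0 V1 n d lam) (v : V) : 0 ≤ lam := by
  have hn : (0 : ℝ) < n := by exact_mod_cast hG.card_pos v
  obtain ⟨-, h0, h1, -, -, -, -, hexp⟩ := hG
  have h := (abs_nonneg _).trans (hexp V0 V1 subset_rfl subset_rfl)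
  rw [h0, h1, Real.sqrt_mul_self hn.le] at h
  exact nonneg_of_mul_nonneg_left h hn

lemma card_mul_card_le (hG : IsBiExpander G V0 V1 n d lam) (hn : 0 < n) (hd : 0 < d)
    {S T : Finset V} (hS : S ⊆ V0) (hT : T ⊆ V1) (h : ∀ u ∈ S, ∀ v ∈ T, ¬ G.Adj u v) :
    (S.card : ℝ) * T.card ≤ (lam * n / d) ^ 2 := by
  have hn' : (0 : ℝ) < n := by exact_mod_cast hn
  have hd' : (0 : ℝ) < d := by exact_mod_cast hd
  obtain ⟨-, -, -, -, -, -, -, hexp⟩ := hG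
  have h' := hexp S T hS hT
  rw [edgeCount_eq_zero G h, Nat.cast_zero, zero_sub, abs_neg, mul_assoc,
    abs_of_nonneg (by positivity)] at h'
  set x : ℝ := (S.card : ℝ) * T.card
  have hx : 0 ≤ x := by positivity
  obtain ⟨r, hr, hrx⟩ : ∃ r : ℝ, 0 ≤ r ∧ x = r ^ 2 :=
    ⟨√x, Real.sqrt_nonneg _, (Real.sq_sqrt hx).symm⟩
  rw [hrx, Real.sqrt_sq hr] at h'
  rw [hrx]
  rcases hr.eq_or_lt with rfl | hr
  · rw [zero_pow two_ne_zero]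
    positivity
  · apply pow_le_pow_left₀ hr.le
    rw [le_div_iff₀ hd']
    have : (d : ℝ) / n * r ≤ lam := by
      apply le_of_mul_le_mul_right _ hr
      linarith
    rw [div_mul_eq_mul_div, div_le_iff₀ hn'] at this
    linarith

/-- A nonempty union of connected components of a good bi-expander fills more than two thirds
of each color class. -/
lemma two_mul_lt_three_mul_card (hG : IsBiExpander G V0 V1 n d lam) (hlam : lam < (d : ℝ) / 3)
    (hn : 0 < n) (hd : 0 < d) {S T : Finset V} (hS : S ⊆ V0) (hT : T ⊆ V1) (hS' : S.Nonempty)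
    (hST : ∀ u ∈ S, ∀ v, G.Adj u v → v ∈ T) (hTS : ∀ v ∈ T, ∀ u, G.Adj v u → u ∈ S) :
    2 * n < 3 * S.card := by
  have hn' : (0 : ℝ) < n := by exact_mod_cast hn
  have hd' : (0 : ℝ) < d := by exact_mod_cast hd
  obtain ⟨-, -, -, -, -, -, hdeg, hexp⟩ := hG
  have heq := edgeCount_eq_mul_card G hdeg hST
  have hcard : T.card = S.card := by
    have h := edgeCount_eq_mul_card G hdeg hTS
    rw [edgeCount_comm, heq] at h
    exact (Nat.eq_of_mul_eq_mul_left hd h).symm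
  have hs : (0 : ℝ) < S.card := by exact_mod_cast hS'.card_pos
  have h := (le_abs_self _).trans (hexp S T hS hT)
  rw [heq, hcard, Real.sqrt_mul_self hs.le, Nat.cast_mul, ← sub_mul] at h
  have h' := le_of_mul_le_mul_right h hs
  have h'' : (d : ℝ) * (2 / 3) < d * (S.card / n) := by
    have : (d : ℝ) / n * S.card = d * (S.card / n) := by ring
    linarith
  have := lt_of_mul_lt_mul_left h'' hd'.le
  rw [lt_div_iff₀ hn'] at this
  have : (2 : ℝ) * n < 3 * S.card := by linarith
  exact_mod_cast this

/-- All heights on a color class of a good bi-expander have the same parity. -/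
lemma parity_eq (hG : IsBiExpander G V0 V1 n d lam) (hlam : lam < (d : ℝ) / 3)
    (hd : 0 < d) {f : V → ℤ} (hf : ∀ u v, G.Adj u v → |f u - f v| = 1)
    {v w : V} (hv : v ∈ V0) (hw : w ∈ V0) : 2 ∣ f v - f w := by
  classical
  by_contra hvw
  have hn := hG.card_pos v
  have hlarge (x : V) (hx : x ∈ V0) : 2 * n < 3 * (V0.filter fun y => 2 ∣ f y - f x).card := by
    obtain ⟨-, -, -, -, hdisj, hadj, -, -⟩ := id hG
    refine hG.two_mul_lt_three_mul_card hlam hn hd (Finset.filter_subset _ _)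
      (T := V1.filter fun y => ¬ 2 ∣ f y - f x) (Finset.filter_subset _ _)
      ⟨x, by simp [hx]⟩ ?_ ?_
    · intro a ha b hab
      rw [Finset.mem_filter] at ha ⊢
      have h1 := eq_or_eq_neg_of_abs_eq (hf a b hab)
      have h2 := hadj a b hab
      have h3 := Finset.disjoint_left.1 hdisj ha.1
      exact ⟨by tauto, by omega⟩
    · intro a ha b hab
      rw [Finset.mem_filter] at ha ⊢
      have h1 := eq_or_eq_neg_of_abs_eq (hf a b hab)
      have h2 := hadj a b hab
      have h3 := Finset.disjoint_right.1 hdisj ha.1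
      exact ⟨by tauto, by omega⟩
  have hdisj : Disjoint (V0.filter fun y => 2 ∣ f y - f v) (V0.filter fun y => 2 ∣ f y - f w) := by
    rw [Finset.disjoint_left]
    intro y
    simp only [Finset.mem_filter]
    omega
  have hle := Finset.card_le_card (Finset.union_subset
    (Finset.filter_subset (fun y => 2 ∣ f y - f v) V0)
    (Finset.filter_subset (fun y => 2 ∣ f y - f w) V0))
  rw [Finset.card_union_of_disjoint hdisj, hG.2.1] at hle
  have := hlarge v hv
  have := hlarge w hw
  omega

/-- The vertices whose height has a given parity form one of the two color classes. -/
lemma filter_parity_eq (hG : IsBiExpander G V0 V1 n d lam) (hlam : lam < (d : ℝ) / 3)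
    (hd : 0 < d) {f : V → ℤ} (hf : ∀ u v, G.Adj u v → |f u - f v| = 1) (v : V) (k : ℤ) :
    ((Finset.univ.filter fun w => 2 ∣ f w - k) = V0 ∧
        (Finset.univ.filter fun w => 2 ∣ f w - (k + 1)) = V1) ∨
      ((Finset.univ.filter fun w => 2 ∣ f w - k) = V1 ∧
        (Finset.univ.filter fun w => 2 ∣ f w - (k + 1)) = V0) := by
  have hn := hG.card_pos v
  obtain ⟨-, h0, -, hcover, hdisj, hadj, hdeg, -⟩ := id hG
  obtain ⟨a, ha⟩ : V0.Nonempty := Finset.card_pos.1 (by omega)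
  obtain ⟨b, hab⟩ : ∃ b, G.Adj a b := by
    apply (G.degree_pos_iff_exists_adj a).1
    rw [hdeg]
    exact hd
  have hb : b ∈ V1 := by
    have := hadj a b hab
    have := Finset.disjoint_left.1 hdisj ha
    tauto
  have hfab := eq_or_eq_neg_of_abs_eq (hf a b hab)
  have hV0 (w : V) (hw : w ∈ V0) : 2 ∣ f w - f a := hG.parity_eq hlam hd hf hw ha
  have hV1 (w : V) (hw : w ∈ V1) : 2 ∣ f w - f b := hG.symm.parity_eq hlam hd hf hw hb
  have hmem (w : V) : (w ∈ V0 ↔ 2 ∣ f w - f a) ∧ (w ∈ V1 ↔ ¬ 2 ∣ f w - f a) := by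
    rcases hcover w with hw | hw
    · have := hV0 w hw
      have := Finset.disjoint_left.1 hdisj hw
      tauto
    · have := hV1 w hw
      have : ¬ 2 ∣ f w - f a := by omega
      have := Finset.disjoint_right.1 hdisj hw
      tauto
  by_cases hk : 2 ∣ f a - k
  · left
    constructor
    all_goals
      ext w
      simp only [Finset.mem_filter, Finset.mem_univ, true_and, hmem]
      omega
  · right
    constructor
    all_goals
      ext w
      simp only [Finset.mem_filter, Finset.mem_univ, true_and, hmem]
      omega

end IsBiExpander

theorem stmt4 {V : Type*} [Fintype V] [DecidableEq V] (G : SimpleGraph V) [DecidableRel G.Adj]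
    (V0 V1 : Finset V) (n d : ℕ) (lam : ℝ)
    (hG : IsBiExpander G V0 V1 n d lam) (hlam : lam < (d : ℝ) / 3) (v₀ : V) :
    ∀ f ∈ HomSet G v₀, ∃ W : Finset V, (W = V0 ∨ W = V1) ∧ ∃ k : ℤ,
      (((W.filter (fun v => f v ≠ k)).card : ℝ)) ≤ 2 * lam * n / d ∧
      ({v : V | 2 ≤ |f v - k|}.ncard : ℝ) ≤ 3 * lam * n / d := by
  rintro f ⟨-, hf⟩
  have hn := hG.card_pos v₀
  have hn' : (0 : ℝ) < n := by exact_mod_cast hn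
  have hlam0 := hG.lam_nonneg v₀
  have hd' : (0 : ℝ) < d := by linarith
  have hd : 0 < d := by exact_mod_cast hd'
  have hclass := hG.filter_parity_eq hlam hd hf v₀
  have hμ : 3 * (lam * n / d) < n := by
    rw [← mul_div_assoc, div_lt_iff₀ hd']
    nlinarith
  have hcard (j : ℤ) : (Finset.univ.filter fun v => 2 ∣ f v - j).card = n := by
    rcases hclass j with h | h
    · rw [h.1, hG.2.1]
    · rw [h.1, hG.2.2.1]
  have hexp (j : ℤ) :
      ((lowerLevels f j).card : ℝ) * (upperLevels f (j + 3)).card ≤ (lam * n / d) ^ 2 := by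
    have hlower : lowerLevels f j ⊆ Finset.univ.filter fun v => 2 ∣ f v - j :=
      Finset.monotone_filter_right _ fun v _ hv => hv.2
    have hupper : upperLevels f (j + 3) ⊆ Finset.univ.filter fun v => 2 ∣ f v - (j + 1) := by
      refine Finset.monotone_filter_right _ fun v _ hv => ?_
      have := hv.2
      omega
    have hno : ∀ u ∈ lowerLevels f j, ∀ v ∈ upperLevels f (j + 3), ¬ G.Adj u v := by
      intro u hu v hv huv
      have h := eq_or_eq_neg_of_abs_eq (hf u v huv)
      have hu' := (Finset.mem_filter.1 hu).2.1
      have hv' := (Finset.mem_filter.1 hv).2.1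
      omega
    rcases hclass j with ⟨h, h'⟩ | ⟨h, h'⟩
    · exact hG.card_mul_card_le hn hd (h ▸ hlower) (h' ▸ hupper) hno
    · exact hG.symm.card_mul_card_le hn hd (h ▸ hlower) (h' ▸ hupper) hno
  obtain ⟨k, hk, hk'⟩ := exists_concentrated_level f (by positivity) hμ hcard hexp
  refine ⟨Finset.univ.filter fun v => 2 ∣ f v - k, (hclass k).imp And.left And.left, k, ?_, ?_⟩
  · rw [Finset.filter_filter]
    exact hk.trans_eq (by ring)
  · rw [Set.ncard_eq_toFinset_card', Set.toFinset_ofPred]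
    exact hk'.trans_eq (by ring)
end
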